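/- arXiv:0806.3249 — 2 statements merged into one kernel-verified Lean document; each statement's English description precedes it below -/
import Mathlib

section
/- Let G = (V,E) be a finite simple graph with n vertices and c connected components, let 0 < q < 1, and let v : E → ℝ satisfy: v_e < −q for every bridge e of G, and −1 − √(1−q) < v_e < −1 + √(1−q) for every non-bridge edge e. Then (−1)^{n+c} Z_G(q,v) > 0. -/
open Finset

/-- The number of connected components of the spanning subgraph of a finite graph
with edge set `A`. -/
noncomputable def numCompOfEdges {V : Type*} [Fintype V] (A : Finset (Sym2 V)) : ℕ :=
  Nat.card (SimpleGraph.fromEdgeSet (A : Set (Sym2 V))).ConnectedComponent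

/-- The multivariate Tutte polynomial `Z_G(q, v) = ∑_{A ⊆ E} q^{k(A)} ∏_{e ∈ A} v_e`. -/
noncomputable def tutteZ {V : Type*} [Fintype V] [DecidableEq V] (G : SimpleGraph V)
    [DecidableRel G.Adj] (q : ℝ) (v : Sym2 V → ℝ) : ℝ :=
  ∑ A ∈ G.edgeFinset.powerset, q ^ numCompOfEdges A * ∏ e ∈ A, v e

/-- A function on finite sets is a *matroid corank* if, up to an additive constant, it is the
negative of a matroid rank function: adding an element lowers it by at most one, and an element
that does not lower it on a set does not lower it on any larger set. -/
structure IsMatroidCorank {α : Type*} [DecidableEq α] (k : Finset α → ℕ) : Prop where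
  insert_eq_or (e : α) (A : Finset α) : k (insert e A) = k A ∨ k (insert e A) + 1 = k A
  insert_eq_of_subset {e : α} {A B : Finset α} (hAB : A ⊆ B) (h : k (insert e A) = k A) :
    k (insert e B) = k B

/-- The generating function `∑_{A ⊆ S} q^{k(A)} ∏_{e ∈ A} v_e` of a set function `k`. -/
noncomputable def corankSum {α : Type*} (q : ℝ) (k : Finset α → ℕ) (v : α → ℝ)
    (S : Finset α) : ℝ :=
  ∑ A ∈ S.powerset, q ^ k A * ∏ e ∈ A, v e

/-- The conditions on the weights of coloops, loops and all other elements of `S`. -/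
def CorankAdmissible {α : Type*} [DecidableEq α] (q : ℝ) (k : Finset α → ℕ) (v : α → ℝ)
    (S : Finset α) : Prop :=
  ∀ e ∈ S, (k (S.erase e) ≠ k S → v e < -q) ∧ (k {e} = k ∅ → -1 < v e) ∧
    (k {e} ≠ k ∅ → k (S.erase e) = k S → (1 + v e) ^ 2 < 1 - q)

namespace IsMatroidCorank

variable {α : Type*} [DecidableEq α] {k : Finset α → ℕ}

/-- Contracting an element preserves matroid coranks. -/
lemma contract (hk : IsMatroidCorank k) (f : α) :
    IsMatroidCorank (fun A ↦ k (insert f A)) where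
  insert_eq_or e A := by
    rw [insert_comm]
    exact hk.insert_eq_or e _
  insert_eq_of_subset {e A B} hAB h := by
    rw [insert_comm] at h ⊢
    exact hk.insert_eq_of_subset (insert_subset_insert f hAB) h

lemma insert_add_one (hk : IsMatroidCorank k) {e : α} {A : Finset α}
    (h : k (insert e A) ≠ k A) : k (insert e A) + 1 = k A :=
  (hk.insert_eq_or e A).resolve_left h

lemma insert_add_one_of_subset (hk : IsMatroidCorank k) {e : α} {A B : Finset α} (hAB : A ⊆ B)
    (h : k (insert e B) ≠ k B) : k (insert e A) + 1 = k A :=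
  hk.insert_add_one fun h' ↦ h (hk.insert_eq_of_subset hAB h')

end IsMatroidCorank

section corankSum

variable {α : Type*} {q : ℝ} {k k' : Finset α → ℕ} {v v' : α → ℝ} {S : Finset α}

lemma corankSum_insert [DecidableEq α] {e : α} (he : e ∉ S) :
    corankSum q k v (insert e S) =
      corankSum q k v S + v e * corankSum q (fun A ↦ k (insert e A)) v S := by
  simp only [corankSum]
  rw [sum_powerset_insert he, mul_sum]
  congr 1
  refine sum_congr rfl fun A hA ↦ ?_
  rw [prod_insert fun h ↦ he (mem_powerset.1 hA h)]
  ring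

lemma corankSum_congr (hk : ∀ A ⊆ S, k A = k' A) (hv : ∀ e ∈ S, v e = v' e) :
    corankSum q k v S = corankSum q k' v' S := by
  refine sum_congr rfl fun A hA ↦ ?_
  rw [mem_powerset] at hA
  rw [hk A hA, prod_congr rfl fun e he ↦ hv e (hA he)]

lemma corankSum_of_add_one (hk : ∀ A ⊆ S, k' A + 1 = k A) :
    corankSum q k v S = q * corankSum q k' v S := by
  rw [corankSum, corankSum, mul_sum]
  refine sum_congr rfl fun A hA ↦ ?_
  rw [← hk A (mem_powerset.1 hA)]
  ring

end corankSum

section reductions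

variable {α : Type*} [DecidableEq α] {q : ℝ} {k : Finset α → ℕ} {v : α → ℝ} {T : Finset α}
  {e f : α}

lemma corankSum_insert_of_loop (hk : IsMatroidCorank k) (he : e ∉ T) (hloop : k {e} = k ∅) :
    corankSum q k v (insert e T) = (1 + v e) * corankSum q k v T := by
  rw [corankSum_insert he, corankSum_congr (k' := k) (v' := v)
    (fun A _ ↦ hk.insert_eq_of_subset (empty_subset A) hloop) fun _ _ ↦ rfl]
  ring

lemma corankSum_insert_of_coloop (hk : IsMatroidCorank k) (he : e ∉ T)
    (hco : k (insert e T) ≠ k T) :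
    corankSum q k v (insert e T) =
      (q + v e) * corankSum q (fun A ↦ k (insert e A)) v T := by
  rw [corankSum_insert he, corankSum_of_add_one
    (fun A hA ↦ hk.insert_add_one_of_subset hA hco)]
  ring

/-- Two parallel elements can be replaced by one. -/
lemma corankSum_parallel (hk : IsMatroidCorank k) (hef : e ≠ f) (he : e ∉ T) (hf : f ∉ T)
    (hle : k {e} ≠ k ∅) (hlf : k {f} ≠ k ∅) (hpar : k {f, e} = k {e}) :
    corankSum q k v (insert f (insert e T)) =
      corankSum q k (Function.update v e ((1 + v e) * (1 + v f) - 1)) (insert e T) := by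
  have h₁ := hk.insert_add_one (A := ∅) hle
  have h₂ := hk.insert_add_one (A := ∅) hlf
  simp only [insert_empty_eq] at h₁ h₂
  have hfe (A : Finset α) : k (insert f (insert e A)) = k (insert e A) :=
    hk.insert_eq_of_subset (A := {e}) (by simp) hpar
  have hef' (A : Finset α) : k (insert e (insert f A)) = k (insert f A) :=
    hk.insert_eq_of_subset (A := {f}) (by simp) (by rw [pair_comm, hpar]; omega)
  have hv : ∀ x ∈ T, Function.update v e ((1 + v e) * (1 + v f) - 1) x = v x := fun x hx ↦
    Function.update_of_ne (ne_of_mem_of_not_mem hx he) _ _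
  have hf' : f ∉ insert e T := by simp [hef.symm, hf]
  rw [corankSum_insert hf', corankSum_insert he, corankSum_insert he, corankSum_insert he,
    corankSum_congr (fun _ _ ↦ rfl) hv, corankSum_congr (fun _ _ ↦ rfl) hv,
    Function.update_self,
    corankSum_congr (k := fun A ↦ k (insert f A)) (k' := fun A ↦ k (insert e A)) (v' := v)
      (fun A _ ↦ by rw [← hfe, ← hef', insert_comm]) fun _ _ ↦ rfl,
    corankSum_congr (k := fun A ↦ k (insert f (insert e A))) (k' := fun A ↦ k (insert e A))
      (v' := v) (fun A _ ↦ hfe A) fun _ _ ↦ rfl]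
  ring

/-- Two elements in series can be replaced by one. -/
lemma corankSum_series (hk : IsMatroidCorank k) (hef : e ≠ f) (he : e ∉ T) (hf : f ∉ T)
    (hce : k (insert e T) ≠ k T) (hcf : k (insert f T) ≠ k T) (hq : q + v e + v f ≠ 0) :
    corankSum q k v (insert f (insert e T)) =
      (q + v e + v f) * corankSum q (fun A ↦ k (insert f A))
        (Function.update v e (v e * v f / (q + v e + v f))) (insert e T) := by
  have h₁ (A) (hA : A ⊆ T) := hk.insert_add_one_of_subset hA hce
  have h₂ (A) (hA : A ⊆ T) := hk.insert_add_one_of_subset hA hcf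
  have hv : ∀ x ∈ T, Function.update v e (v e * v f / (q + v e + v f)) x = v x := fun x hx ↦
    Function.update_of_ne (ne_of_mem_of_not_mem hx he) _ _
  have hf' : f ∉ insert e T := by simp [hef.symm, hf]
  rw [corankSum_insert hf', corankSum_insert he, corankSum_insert he, corankSum_insert he,
    corankSum_congr (fun _ _ ↦ rfl) hv, corankSum_congr (fun _ _ ↦ rfl) hv,
    Function.update_self, corankSum_of_add_one h₂,
    corankSum_congr (k := fun A ↦ k (insert e A)) (k' := fun A ↦ k (insert f A)) (v' := v)
      (fun A hA ↦ by have := h₁ A hA; have := h₂ A hA; omega) fun _ _ ↦ rfl]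
  field_simp
  ring

end reductions

section weights

variable {q a b : ℝ}

lemma mul_lt_one_sub (ha : a ^ 2 < 1 - q) (hb : b ^ 2 < 1 - q) : a * b < 1 - q := by
  nlinarith [sq_nonneg (a - b)]

lemma sq_mul_lt_one_sub (hq : 0 < q) (ha : a ^ 2 < 1 - q) (hb : b ^ 2 < 1 - q) :
    (a * b) ^ 2 < 1 - q := by
  nlinarith [sq_nonneg a, sq_nonneg b]

lemma series_denom_neg (ha : (1 + a) ^ 2 < 1 - q) (hb : (1 + b) ^ 2 < 1 - q) :
    q + a + b < 0 := by
  nlinarith [sq_nonneg a, sq_nonneg b]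

lemma neg_one_lt_series (ha : (1 + a) ^ 2 < 1 - q) (hb : (1 + b) ^ 2 < 1 - q) :
    -1 < a * b / (q + a + b) := by
  rw [lt_div_iff_of_neg (series_denom_neg ha hb)]
  linarith [mul_lt_one_sub ha hb]

lemma sq_one_add_series_lt (ha : (1 + a) ^ 2 < 1 - q) (hb : (1 + b) ^ 2 < 1 - q) :
    (1 + a * b / (q + a + b)) ^ 2 < 1 - q := by
  have hd := series_denom_neg ha hb
  have hab := mul_lt_one_sub ha hb
  have hq' : 0 < 1 - q := (sq_nonneg _).trans_lt ha
  obtain ⟨s, hs, hsq⟩ : ∃ s : ℝ, 0 < s ∧ s ^ 2 = 1 - q :=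
    ⟨√(1 - q), Real.sqrt_pos.2 hq', Real.sq_sqrt hq'.le⟩
  have has : 1 + a < s := lt_of_pow_lt_pow_left₀ 2 hs.le (by rwa [hsq])
  have hbs : 1 + b < s := lt_of_pow_lt_pow_left₀ 2 hs.le (by rwa [hsq])
  have key : 1 - q - (1 + a) * (1 + b) < s * -(q + a + b) := by
    have hq_eq : q = 1 - s ^ 2 := by linarith
    rw [hq_eq]
    nlinarith [mul_pos (sub_pos.2 has) (sub_pos.2 hbs), mul_nonneg hs.le (sq_nonneg (1 - s))]
  have heq : 1 + a * b / (q + a + b) = (1 - q - (1 + a) * (1 + b)) / -(q + a + b) := by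
    have := hd.ne
    rw [eq_div_iff (neg_ne_zero.2 this)]
    linear_combination -div_mul_cancel₀ (a * b) this
  rw [heq]
  refine lt_of_lt_of_eq ?_ hsq
  refine pow_lt_pow_left₀ ?_ (div_nonneg (by linarith) (by linarith)) two_ne_zero
  rwa [div_lt_iff₀ (by linarith)]

end weights

lemma neg_one_pow_mul_pos_of_succ {m n : ℕ} {x : ℝ} (hmn : m + 1 = n)
    (h : 0 < (-1 : ℝ) ^ m * x) {c : ℝ} (hc : c < 0) : 0 < (-1 : ℝ) ^ n * (c * x) := by
  rw [← hmn, pow_succ]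
  nlinarith [mul_pos h (neg_pos.2 hc)]

section admissible

variable {α : Type*} [DecidableEq α] {q : ℝ} {k : Finset α → ℕ} {v : α → ℝ} {T : Finset α}
  {e f : α}

lemma CorankAdmissible.of_insert_loop (hk : IsMatroidCorank k) (he : e ∉ T)
    (hloop : k {e} = k ∅) (h : CorankAdmissible q k v (insert e T)) :
    CorankAdmissible q k v T := by
  intro g hg
  have hge : e ≠ g := fun h ↦ he (h ▸ hg)
  have h' := h g (mem_insert_of_mem hg)
  rwa [erase_insert_of_ne hge, hk.insert_eq_of_subset (empty_subset _) hloop,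
    hk.insert_eq_of_subset (empty_subset _) hloop] at h'

lemma CorankAdmissible.of_insert_coloop (hk : IsMatroidCorank k) (he : e ∉ T)
    (hco : k (insert e T) ≠ k T) (h : CorankAdmissible q k v (insert e T)) :
    CorankAdmissible q (fun A ↦ k (insert e A)) v T := by
  intro g hg
  have hge : e ≠ g := fun h ↦ he (h ▸ hg)
  have h' := h g (mem_insert_of_mem hg)
  rw [erase_insert_of_ne hge] at h'
  have h₁ : k {e} + 1 = k ∅ := hk.insert_add_one_of_subset (empty_subset T) hco
  have h₂ : k (insert e {g}) + 1 = k {g} :=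
    hk.insert_add_one_of_subset (singleton_subset_iff.2 hg) hco
  refine ⟨h'.1, fun hl ↦ h'.2.1 ?_, fun hl ↦ h'.2.2 ?_⟩ <;>
    simp only [insert_empty_eq] at hl <;> omega

lemma CorankAdmissible.of_parallel (hk : IsMatroidCorank k) (hq : 0 < q) (hef : e ≠ f)
    (he : e ∉ T) (hf : f ∉ T) (hl : ∀ g ∈ insert f (insert e T), k {g} ≠ k ∅)
    (hc : ∀ g ∈ insert f (insert e T),
      k ((insert f (insert e T)).erase g) = k (insert f (insert e T)))
    (hpar : k {f, e} = k {e}) (h : CorankAdmissible q k v (insert f (insert e T))) :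
    CorankAdmissible q k (Function.update v e ((1 + v e) * (1 + v f) - 1)) (insert e T) := by
  have hsq (g) (hg : g ∈ insert f (insert e T)) := (h g hg).2.2 (hl g hg) (hc g hg)
  have hsqe := hsq e (by simp)
  have hsqf := hsq f (by simp)
  intro g hg
  have hlg := hl g (mem_insert_of_mem hg)
  rcases eq_or_ne g e with rfl | hge
  · rw [Function.update_self]
    refine ⟨fun _ ↦ ?_, fun h' ↦ absurd h' hlg, fun _ _ ↦ ?_⟩
    · linarith [mul_lt_one_sub hsqe hsqf]
    · simpa using sq_mul_lt_one_sub hq hsqe hsqf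
  · have hgf : f ≠ g := by
      rintro rfl
      simp_all
    rw [Function.update_of_ne hge]
    refine ⟨fun h' ↦ absurd ?_ h', fun h' ↦ absurd h' hlg,
      fun _ _ ↦ hsq g (mem_insert_of_mem hg)⟩
    have h₁ := hc g (mem_insert_of_mem hg)
    rw [erase_insert_of_ne hgf] at h₁
    rwa [hk.insert_eq_of_subset (A := {e}) (by simp [hge.symm]) hpar,
      hk.insert_eq_of_subset (A := {e}) (by simp) hpar] at h₁

lemma CorankAdmissible.of_series (hk : IsMatroidCorank k) (hef : e ≠ f)
    (he : e ∉ T) (hf : f ∉ T) (hl : ∀ g ∈ insert f (insert e T), k {g} ≠ k ∅)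
    (hc : ∀ g ∈ insert f (insert e T),
      k ((insert f (insert e T)).erase g) = k (insert f (insert e T)))
    (hcf : k (insert f T) ≠ k T) (h : CorankAdmissible q k v (insert f (insert e T))) :
    CorankAdmissible q (fun A ↦ k (insert f A))
      (Function.update v e (v e * v f / (q + v e + v f))) (insert e T) := by
  have hsq (g) (hg : g ∈ insert f (insert e T)) := (h g hg).2.2 (hl g hg) (hc g hg)
  have hsqe := hsq e (by simp)
  have hsqf := hsq f (by simp)
  intro g hg
  have hgf : f ≠ g := by
    rintro rfl
    simp_all
  have h₁ := hc g (mem_insert_of_mem hg)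
  rw [erase_insert_of_ne hgf] at h₁
  refine ⟨fun h' ↦ absurd h₁ h', ?_⟩
  rcases eq_or_ne g e with rfl | hge
  · rw [Function.update_self]
    exact ⟨fun _ ↦ neg_one_lt_series hsqe hsqf, fun _ _ ↦ sq_one_add_series_lt hsqe hsqf⟩
  · rw [Function.update_of_ne hge]
    refine ⟨fun h' ↦ absurd ?_ hcf, fun _ _ ↦ hsq g (mem_insert_of_mem hg)⟩
    have hgT : g ∈ T := (mem_insert.1 hg).resolve_left hge
    have h₂ := hk.insert_add_one (A := ∅) (hl g (mem_insert_of_mem hg))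
    have h₃ := hk.insert_add_one (A := ∅) (hl f (by simp))
    simp only [insert_empty_eq] at h₂ h₃ h'
    exact hk.insert_eq_of_subset (A := {g}) (by simpa using hgT) (by omega)

end admissible

/-- The sign of the generating function of a matroid corank with admissible weights. -/
theorem IsMatroidCorank.corankSum_sign {α : Type*} [DecidableEq α] {q : ℝ} (hq : 0 < q)
    {k : Finset α → ℕ} (hk : IsMatroidCorank k) {v : α → ℝ} {S : Finset α}
    (h : CorankAdmissible q k v S) :
    0 < (-1 : ℝ) ^ (k S + k ∅) * corankSum q k v S := by
  induction hn : S.card generalizing S k v with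
  | zero =>
    obtain rfl := card_eq_zero.1 hn
    simp only [corankSum, powerset_empty, sum_singleton, prod_empty, mul_one,
      (Even.add_self (k ∅)).neg_one_pow, one_mul]
    positivity
  | succ n ih =>
    by_cases hl : ∀ g ∈ S, k {g} ≠ k ∅
    swap
    · push Not at hl
      obtain ⟨e, heS, hloop⟩ := hl
      obtain ⟨T, heT, rfl⟩ : ∃ T, e ∉ T ∧ insert e T = S :=
        ⟨S.erase e, notMem_erase e S, insert_erase heS⟩
      rw [card_insert_of_notMem heT, Nat.add_right_cancel_iff] at hn
      have hpos := ih hk (h.of_insert_loop hk heT hloop) hn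
      rw [corankSum_insert_of_loop hk heT hloop,
        hk.insert_eq_of_subset (empty_subset T) hloop, mul_left_comm]
      exact mul_pos (by linarith [(h e heS).2.1 hloop]) hpos
    by_cases hc : ∀ g ∈ S, k (S.erase g) = k S
    swap
    · push Not at hc
      obtain ⟨e, heS, hco⟩ := hc
      obtain ⟨T, heT, rfl⟩ : ∃ T, e ∉ T ∧ insert e T = S :=
        ⟨S.erase e, notMem_erase e S, insert_erase heS⟩
      have hve := (h e heS).1 hco
      rw [erase_insert heT] at hco
      rw [card_insert_of_notMem heT, Nat.add_right_cancel_iff] at hn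
      have hpos := ih (hk.contract e) (h.of_insert_coloop hk heT hco.symm) hn
      rw [corankSum_insert_of_coloop hk heT hco.symm]
      have h₁ : k (insert e ∅) + 1 = k ∅ :=
        hk.insert_add_one_of_subset (empty_subset T) hco.symm
      exact neg_one_pow_mul_pos_of_succ (by omega) hpos (by linarith)
    have hsq (g) (hg : g ∈ S) := (h g hg).2.2 (hl g hg) (hc g hg)
    obtain ⟨e, heS⟩ : S.Nonempty := card_pos.1 (by omega)
    by_cases hpar : ∃ f ∈ S, f ≠ e ∧ k {f, e} = k {e}
    · obtain ⟨f, hfS, hfe, hpar⟩ := hpar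
      obtain ⟨T, heT, hfT, rfl⟩ : ∃ T, e ∉ T ∧ f ∉ T ∧ insert f (insert e T) = S :=
        ⟨(S.erase f).erase e, by simp, by simp, by
          rw [insert_erase (mem_erase.2 ⟨hfe.symm, heS⟩), insert_erase hfS]⟩
      rw [card_insert_of_notMem (by simp [hfe, hfT]), Nat.add_right_cancel_iff] at hn
      have hpos := ih hk (h.of_parallel hk hq hfe.symm heT hfT hl hc hpar) hn
      rwa [corankSum_parallel hk hfe.symm heT hfT (hl e heS) (hl f hfS) hpar,
        hk.insert_eq_of_subset (A := {e}) (by simp) hpar]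
    by_cases hser : ∃ f ∈ S, f ≠ e ∧ k ((S.erase f).erase e) ≠ k S
    · obtain ⟨f, hfS, hfe, hser⟩ := hser
      obtain ⟨T, heT, hfT, rfl⟩ : ∃ T, e ∉ T ∧ f ∉ T ∧ insert f (insert e T) = S :=
        ⟨(S.erase f).erase e, by simp, by simp, by
          rw [insert_erase (mem_erase.2 ⟨hfe.symm, heS⟩), insert_erase hfS]⟩
      have hf' : f ∉ insert e T := by simp [hfe, hfT]
      have hce := hc e heS
      have hcf := hc f hfS
      rw [erase_insert hf'] at hcf hser
      rw [erase_insert heT] at hser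
      rw [erase_insert_of_ne hfe, erase_insert heT] at hce
      rw [card_insert_of_notMem hf', Nat.add_right_cancel_iff] at hn
      have hdenom := series_denom_neg (hsq e heS) (hsq f hfS)
      have hpos := ih (hk.contract f) (h.of_series hk hfe.symm heT hfT hl hc (by omega)) hn
      rw [corankSum_series hk hfe.symm heT hfT (by omega) (by omega) hdenom.ne]
      have h₁ := hk.insert_add_one (A := ∅) (hl f hfS)
      exact neg_one_pow_mul_pos_of_succ (by omega) hpos hdenom
    push Not at hpar hser
    obtain ⟨T, heT, rfl⟩ : ∃ T, e ∉ T ∧ insert e T = S :=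
      ⟨S.erase e, notMem_erase e S, insert_erase heS⟩
    rw [card_insert_of_notMem heT, Nat.add_right_cancel_iff] at hn
    have hce := hc e heS
    rw [erase_insert heT] at hce
    have hve : v e < 0 := by nlinarith [hsq e heS, sq_nonneg (v e)]
    have hdel : CorankAdmissible q k v T := by
      intro g hg
      have hge : g ≠ e := fun h ↦ heT (h ▸ hg)
      have hg' := mem_insert_of_mem (b := e) hg
      refine ⟨fun h' ↦ absurd ?_ h', fun h' ↦ absurd h' (hl g hg'), fun _ _ ↦ hsq g hg'⟩
      have := hser g hg' hge
      rwa [erase_right_comm, erase_insert heT, ← hce] at this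
    have hcon : CorankAdmissible q (fun A ↦ k (insert e A)) v T := by
      intro g hg
      have hge : g ≠ e := fun h ↦ heT (h ▸ hg)
      have hg' := mem_insert_of_mem (b := e) hg
      have h₁ := hc g hg'
      rw [erase_insert_of_ne hge.symm] at h₁
      refine ⟨fun h' ↦ absurd h₁ h', fun h' ↦ absurd ?_ (hpar g hg' hge), fun _ _ ↦ hsq g hg'⟩
      rwa [pair_comm]
    have hpos := ih hk hdel hn
    have h₁ := hk.insert_add_one (A := ∅) (hl e heS)
    have hpos' := neg_one_pow_mul_pos_of_succ (n := k (insert e T) + k ∅) (by omega)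
      (ih (hk.contract e) hcon hn) hve
    rw [corankSum_insert heT, mul_add]
    rw [hce] at hpos
    exact add_pos hpos hpos'

namespace SimpleGraph

variable {V : Type*} {H : SimpleGraph V} {u v : V}

lemma Reachable.sup_edge_iff (h : H.Reachable u v) (x y : V) :
    (H ⊔ edge u v).Reachable x y ↔ H.Reachable x y := by
  refine ⟨?_, fun h ↦ h.mono le_sup_left⟩
  rintro ⟨p⟩
  induction p with
  | nil => rfl
  | cons hadj _ ih =>
    refine Reachable.trans ?_ ih
    rw [sup_adj, edge_adj] at hadj
    rcases hadj with hadj | ⟨⟨rfl, rfl⟩ | ⟨rfl, rfl⟩, -⟩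
    exacts [hadj.reachable, h, h.symm]

lemma Reachable.card_connectedComponent_sup_edge (h : H.Reachable u v) :
    Nat.card (H ⊔ edge u v).ConnectedComponent = Nat.card H.ConnectedComponent :=
  Nat.card_congr (Quot.congrRight (h.sup_edge_iff))

/-- Joining two components by an edge merges them. -/
lemma card_connectedComponent_sup_edge_add_one [Finite V] (h : ¬ H.Reachable u v) :
    Nat.card (H ⊔ edge u v).ConnectedComponent + 1 = Nat.card H.ConnectedComponent := by
  classical
  have huv : u ≠ v := fun huv ↦ h (huv ▸ Reachable.refl u)
  have hu : H.connectedComponentMk u ≠ H.connectedComponentMk v :=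
    fun h' ↦ h (ConnectedComponent.eq.1 h')
  let K := {C : H.ConnectedComponent // C ≠ H.connectedComponentMk v}
  let f (x : V) : K :=
    if hx : H.connectedComponentMk x = H.connectedComponentMk v then ⟨_, hu⟩ else ⟨_, hx⟩
  have hf (x y : V) (hxy : (H ⊔ edge u v).Adj x y) : f x = f y := by
    rw [sup_adj, edge_adj] at hxy
    rcases hxy with hxy | ⟨⟨rfl, rfl⟩ | ⟨rfl, rfl⟩, -⟩
    · simp only [f, ConnectedComponent.connectedComponentMk_eq_of_adj hxy]
    · simp [f]
    · simp [f]
  have hf' (x y : V) (p : (H ⊔ edge u v).Walk x y) : f x = f y := by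
    induction p with
    | nil => rfl
    | cons hadj _ ih => exact (hf _ _ hadj).trans ih
  let φ := ConnectedComponent.map (Hom.ofLE (le_sup_left : H ≤ H ⊔ edge u v))
  have hadj : (H ⊔ edge u v).Adj u v := by simp [edge_adj, huv]
  let equiv : (H ⊔ edge u v).ConnectedComponent ≃ K :=
    { toFun := ConnectedComponent.lift f fun x y p _ ↦ hf' x y p
      invFun C := φ C
      left_inv C := by
        induction C using ConnectedComponent.ind with | _ x
        by_cases hx : H.connectedComponentMk x = H.connectedComponentMk v
        · simp only [ConnectedComponent.lift_mk, f, hx, dite_true]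
          have : φ (H.connectedComponentMk x) = φ (H.connectedComponentMk v) := by rw [hx]
          exact (ConnectedComponent.connectedComponentMk_eq_of_adj hadj).trans this.symm
        · simp only [ConnectedComponent.lift_mk, f, hx, dite_false]
          rfl
      right_inv C := by
        obtain ⟨C, hC⟩ := C
        induction C using ConnectedComponent.ind with | _ x
        exact dif_neg hC }
  rw [Nat.card_congr equiv]
  have := Fintype.ofFinite H.ConnectedComponent
  have hcard := Fintype.card_subtype_compl (fun C ↦ C = H.connectedComponentMk v)
  have hpos : 0 < Fintype.card H.ConnectedComponent :=
    Fintype.card_pos_iff.2 ⟨H.connectedComponentMk v⟩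
  rw [Fintype.card_subtype_eq] at hcard
  rw [Nat.card_eq_fintype_card, Nat.card_eq_fintype_card]
  simp only [K, ne_eq]
  omega

lemma card_connectedComponent_sup_edge_eq_iff [Finite V] :
    Nat.card (H ⊔ edge u v).ConnectedComponent = Nat.card H.ConnectedComponent ↔
      H.Reachable u v := by
  refine ⟨fun h ↦ ?_, Reachable.card_connectedComponent_sup_edge⟩
  by_contra h'
  have := card_connectedComponent_sup_edge_add_one h'
  omega

end SimpleGraph

section numCompOfEdges

variable {V : Type*} [Fintype V] [DecidableEq V]

lemma numCompOfEdges_insert (x y : V) (A : Finset (Sym2 V)) :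
    numCompOfEdges (insert s(x, y) A) = Nat.card
      (SimpleGraph.fromEdgeSet (A : Set (Sym2 V)) ⊔ SimpleGraph.edge x y).ConnectedComponent := by
  rw [numCompOfEdges, coe_insert, Set.insert_eq, SimpleGraph.edge, ← SimpleGraph.fromEdgeSet_union,
    Set.union_comm]

lemma numCompOfEdges_insert_eq_iff (x y : V) (A : Finset (Sym2 V)) :
    numCompOfEdges (insert s(x, y) A) = numCompOfEdges A ↔
      (SimpleGraph.fromEdgeSet (A : Set (Sym2 V))).Reachable x y := by
  rw [numCompOfEdges_insert, numCompOfEdges, SimpleGraph.card_connectedComponent_sup_edge_eq_iff]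

lemma isMatroidCorank_numCompOfEdges :
    IsMatroidCorank (numCompOfEdges : Finset (Sym2 V) → ℕ) where
  insert_eq_or e A := by
    induction e with | _ x y
    rw [numCompOfEdges_insert_eq_iff, numCompOfEdges_insert]
    exact or_iff_not_imp_left.2 SimpleGraph.card_connectedComponent_sup_edge_add_one
  insert_eq_of_subset {e A B} hAB h := by
    induction e with | _ x y
    rw [numCompOfEdges_insert_eq_iff] at h ⊢
    exact h.mono (SimpleGraph.fromEdgeSet_mono (coe_subset.2 hAB))

omit [DecidableEq V] in
lemma numCompOfEdges_empty : numCompOfEdges (∅ : Finset (Sym2 V)) = Fintype.card V := by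
  rw [numCompOfEdges, coe_empty, SimpleGraph.fromEdgeSet_empty, ← Nat.card_eq_fintype_card]
  refine (Nat.card_congr (Equiv.ofBijective
    (SimpleGraph.connectedComponentMk _) ⟨fun x y h ↦ ?_, Quot.mk_surjective⟩)).symm
  simpa using SimpleGraph.ConnectedComponent.eq.1 h

variable (G : SimpleGraph V) [DecidableRel G.Adj]

omit [DecidableEq V] in
lemma numCompOfEdges_edgeFinset :
    numCompOfEdges G.edgeFinset = Nat.card G.ConnectedComponent := by
  rw [numCompOfEdges, SimpleGraph.coe_edgeFinset, SimpleGraph.fromEdgeSet_edgeSet]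

variable {G}

lemma numCompOfEdges_erase_eq_iff {e : Sym2 V} (he : e ∈ G.edgeFinset) :
    numCompOfEdges (G.edgeFinset.erase e) = numCompOfEdges G.edgeFinset ↔ ¬ G.IsBridge e := by
  induction e with | _ x y
  nth_rewrite 2 [← insert_erase he]
  rw [eq_comm, numCompOfEdges_insert_eq_iff, SimpleGraph.isBridge_iff, not_not, coe_erase,
    SimpleGraph.coe_edgeFinset, ← SimpleGraph.deleteEdges_fromEdgeSet,
    SimpleGraph.fromEdgeSet_edgeSet]

lemma numCompOfEdges_singleton_ne {e : Sym2 V} (he : e ∈ G.edgeFinset) :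
    numCompOfEdges {e} ≠ numCompOfEdges (∅ : Finset (Sym2 V)) := by
  induction e with | _ x y
  rw [← insert_empty_eq, Ne, numCompOfEdges_insert_eq_iff]
  have hadj : G.Adj x y := by simpa using he
  simpa using hadj.ne

end numCompOfEdges

/-- Let `G` be a finite simple graph with `n` vertices and `c` components, `0 < q < 1`,
and suppose `v_e < -q` for every bridge `e` and
`-1 - √(1-q) < v_e < -1 + √(1-q)` for every non-bridge edge `e`.
Then `(-1)^{n+c} Z_G(q,v) > 0`. -/
theorem tutteZ_sign_zero_lt_q_lt_one {V : Type*} [Fintype V] [DecidableEq V]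
    (G : SimpleGraph V) [DecidableRel G.Adj]
    (n c : ℕ) (hn : n = Fintype.card V) (hc : c = Nat.card G.ConnectedComponent)
    (q : ℝ) (hq0 : 0 < q) (hq1 : q < 1) (v : Sym2 V → ℝ)
    (hbridge : ∀ e ∈ G.edgeFinset, G.IsBridge e → v e < -q)
    (hnonbridge : ∀ e ∈ G.edgeFinset, ¬G.IsBridge e →
      -1 - Real.sqrt (1 - q) < v e ∧ v e < -1 + Real.sqrt (1 - q)) :
    0 < (-1 : ℝ) ^ (n + c) * tutteZ G q v := by
  subst hn hc
  rw [add_comm, ← numCompOfEdges_edgeFinset, ← numCompOfEdges_empty]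
  refine isMatroidCorank_numCompOfEdges.corankSum_sign hq0 fun e he ↦
    ⟨fun h ↦ hbridge e he ?_, fun h ↦ absurd h (numCompOfEdges_singleton_ne he), fun _ h ↦ ?_⟩
  · by_contra hb
    exact h ((numCompOfEdges_erase_eq_iff he).2 hb)
  · obtain ⟨h₁, h₂⟩ := hnonbridge e he ((numCompOfEdges_erase_eq_iff he).1 h)
    rw [← Real.sq_sqrt (by linarith : 0 ≤ 1 - q)]
    exact sq_lt_sq' (by linarith) (by linarith)
end

section
/- Let M be a matroid with finite ground set E, rank function r, and rank r(M) = r(E); let 0 < q < 1, and let v : E → ℝ satisfy: v_e > −1 for every loop e of M, v_e < −q for every coloop e of M, and −1 − √(1−q) < v_e < −1 + √(1−q) for every element e that is neither a loop nor a coloop. Then (−1)^{r(M)} Z̃_M(q,v) > 0. -/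
open Finset

/-- A matroid with ground set the finite type `α`, presented by its rank function
(normalized, monotone, submodular). -/
structure RankMatroid (α : Type*) [DecidableEq α] where
  r : Finset α → ℕ
  r_le_card : ∀ A : Finset α, r A ≤ A.card
  mono : ∀ ⦃A B : Finset α⦄, A ⊆ B → r A ≤ r B
  submodular : ∀ A B : Finset α, r (A ∪ B) + r (A ∩ B) ≤ r A + r B

/-- The multivariate Tutte polynomial of a matroid:
`Z̃_M(q,v) = ∑_{A ⊆ E} q^{-r(A)} ∏_{e ∈ A} v_e`. -/
noncomputable def matZ {α : Type*} [DecidableEq α] [Fintype α] (M : RankMatroid α)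
    (q : ℝ) (v : α → ℝ) : ℝ :=
  ∑ A ∈ (Finset.univ : Finset α).powerset, q ^ (-(M.r A : ℤ)) * ∏ e ∈ A, v e

/-- An element `e` is a loop of `M` when `r({e}) = 0`. -/
def RankMatroid.IsLoop {α : Type*} [DecidableEq α] (M : RankMatroid α) (e : α) : Prop :=
  M.r {e} = 0

/-- An element `e` is a coloop of `M` when `r(E \ {e}) = r(E) - 1`. -/
def RankMatroid.IsColoop {α : Type*} [DecidableEq α] [Fintype α] (M : RankMatroid α)
    (e : α) : Prop :=
  M.r (Finset.univ.erase e) + 1 = M.r Finset.univ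

namespace RankMatroid

variable {α : Type*} [DecidableEq α]

theorem r_empty (M : RankMatroid α) : M.r ∅ = 0 := by
  simpa using M.r_le_card ∅

theorem r_singleton_le (M : RankMatroid α) (e : α) : M.r {e} ≤ 1 := by
  simpa using M.r_le_card {e}

theorem r_insert_add_le (M : RankMatroid α) (e : α) {A B : Finset α} (h : A ⊆ B) :
    M.r (insert e B) + M.r A ≤ M.r (insert e A) + M.r B := by
  have h1 := M.submodular (insert e A) B
  have h2 : insert e A ∪ B = insert e B := by
    rw [insert_union, union_eq_right.2 h]
  have h3 : M.r A ≤ M.r (insert e A ∩ B) := M.mono (subset_inter (subset_insert _ _) h)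
  rw [h2] at h1
  omega

theorem r_le_r_insert (M : RankMatroid α) (e : α) (A : Finset α) :
    M.r A ≤ M.r (insert e A) :=
  M.mono (subset_insert _ _)

theorem r_insert_le_add_singleton (M : RankMatroid α) (e : α) (A : Finset α) :
    M.r (insert e A) ≤ M.r A + M.r {e} := by
  have h := M.r_insert_add_le e (empty_subset A)
  rw [insert_empty_eq, M.r_empty] at h
  omega

theorem r_insert_le (M : RankMatroid α) (e : α) (A : Finset α) :
    M.r (insert e A) ≤ M.r A + 1 :=
  (M.r_insert_le_add_singleton e A).trans (Nat.add_le_add_left (M.r_singleton_le e) _)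

theorem IsLoop.r_insert {M : RankMatroid α} {e : α} (h : M.IsLoop e) (A : Finset α) :
    M.r (insert e A) = M.r A := by
  have h1 := M.r_insert_le_add_singleton e A
  have h2 := M.r_le_r_insert e A
  rw [IsLoop] at h
  omega

theorem r_insert_eq_add_one_of_subset (M : RankMatroid α) {e : α} {A B : Finset α}
    (hAB : A ⊆ B) (h : M.r (insert e B) = M.r B + 1) : M.r (insert e A) = M.r A + 1 := by
  have h1 := M.r_insert_add_le e hAB
  have h2 := M.r_insert_le e A
  omega

theorem r_insert_eq_of_subset (M : RankMatroid α) {e : α} {A B : Finset α}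
    (hAB : A ⊆ B) (h : M.r (insert e A) = M.r A) : M.r (insert e B) = M.r B := by
  have h1 := M.r_insert_add_le e hAB
  have h2 := M.r_le_r_insert e B
  omega

/-- The contraction `M / e`, on the same ground type, where `e` becomes a loop. -/
def contract (M : RankMatroid α) (e : α) : RankMatroid α where
  r A := M.r (insert e A) - M.r {e}
  r_le_card A := by
    have h1 := M.r_insert_le_add_singleton e A
    have h2 := M.r_le_card A
    omega
  mono A B h := Nat.sub_le_sub_right (M.mono (insert_subset_insert _ h)) _
  submodular A B := by
    have h1 := M.submodular (insert e A) (insert e B)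
    rw [← insert_union_distrib, ← insert_inter_distrib] at h1
    have h2 (C : Finset α) : M.r {e} ≤ M.r (insert e C) :=
      M.mono (singleton_subset_iff.2 (mem_insert_self _ _))
    have := h2 (A ∪ B)
    have := h2 (A ∩ B)
    have := h2 A
    have := h2 B
    omega

theorem contract_r (M : RankMatroid α) (e : α) (A : Finset α) :
    (M.contract e).r A = M.r (insert e A) - M.r {e} := rfl

/-- The multivariate Tutte polynomial of the restriction `M | S`. -/
noncomputable def zOn (M : RankMatroid α) (q : ℝ) (v : α → ℝ) (S : Finset α) : ℝ :=
  ∑ A ∈ S.powerset, q ^ (-(M.r A : ℤ)) * ∏ e ∈ A, v e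

/-- The sign hypotheses on the weights for the restriction `M | S`, at `q = 1 - s ^ 2`. -/
structure Admissible (M : RankMatroid α) (s : ℝ) (v : α → ℝ) (S : Finset α) : Prop where
  loop : ∀ e ∈ S, M.IsLoop e → -1 < v e
  coloop : ∀ e ∈ S, M.r (S.erase e) + 1 = M.r S → v e < s ^ 2 - 1
  normal : ∀ e ∈ S, ¬M.IsLoop e → M.r (S.erase e) + 1 ≠ M.r S → |1 + v e| < s

theorem zOn_insert (M : RankMatroid α) (q : ℝ) (v : α → ℝ) {e : α} {T : Finset α}
    (he : e ∉ T) :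
    M.zOn q v (insert e T) =
      M.zOn q v T + v e * ∑ A ∈ T.powerset, q ^ (-(M.r (insert e A) : ℤ)) * ∏ a ∈ A, v a := by
  rw [zOn, sum_powerset_insert he, zOn, mul_sum]
  congr 1
  refine sum_congr rfl fun A hA => ?_
  rw [prod_insert fun h => he (mem_powerset.1 hA h)]
  ring

theorem zOn_insert_insert (M : RankMatroid α) (q : ℝ) (v : α → ℝ) {e f : α} {T : Finset α}
    (he : e ∉ T) (hf : f ∉ insert e T) :
    M.zOn q v (insert f (insert e T)) = ∑ A ∈ T.powerset,
      (q ^ (-(M.r A : ℤ)) + v e * q ^ (-(M.r (insert e A) : ℤ))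
        + v f * q ^ (-(M.r (insert f A) : ℤ))
        + v e * v f * q ^ (-(M.r (insert f (insert e A)) : ℤ))) * ∏ a ∈ A, v a := by
  rw [M.zOn_insert q v hf, M.zOn_insert q v he, sum_powerset_insert he, zOn, mul_add, mul_sum,
    mul_sum, mul_sum, ← sum_add_distrib, ← sum_add_distrib, ← sum_add_distrib]
  refine sum_congr rfl fun A hA => ?_
  rw [prod_insert fun h => he (mem_powerset.1 hA h)]
  ring

theorem zOn_insert_update (M : RankMatroid α) (q : ℝ) (v : α → ℝ) (x : ℝ) {e : α}
    {T : Finset α} (he : e ∉ T) :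
    M.zOn q (Function.update v e x) (insert e T) = ∑ A ∈ T.powerset,
      (q ^ (-(M.r A : ℤ)) + x * q ^ (-(M.r (insert e A) : ℤ))) * ∏ a ∈ A, v a := by
  rw [M.zOn_insert _ _ he, zOn, mul_sum, ← sum_add_distrib]
  refine sum_congr rfl fun A hA => ?_
  have h : ∏ a ∈ A, Function.update v e x a = ∏ a ∈ A, v a :=
    prod_update_of_notMem (fun h => he (mem_powerset.1 hA h)) _ _
  rw [h, Function.update_self]
  ring

theorem zOn_insert_of_isLoop (M : RankMatroid α) (q : ℝ) (v : α → ℝ) {e : α} {T : Finset α}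
    (he : e ∉ T) (h : M.IsLoop e) : M.zOn q v (insert e T) = (1 + v e) * M.zOn q v T := by
  rw [M.zOn_insert q v he]
  simp only [h.r_insert]
  rw [← zOn]
  ring

theorem zOn_insert_of_coloop (M : RankMatroid α) {q : ℝ} (hq : q ≠ 0) (v : α → ℝ) {e : α}
    {T : Finset α} (he : e ∉ T) (h : M.r (insert e T) = M.r T + 1) :
    M.zOn q v (insert e T) = (1 + v e / q) * M.zOn q v T := by
  rw [M.zOn_insert q v he, zOn, mul_sum, mul_sum, ← sum_add_distrib]
  refine sum_congr rfl fun A hA => ?_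
  rw [M.r_insert_eq_add_one_of_subset (mem_powerset.1 hA) h, Nat.cast_add, neg_add,
    zpow_add₀ hq, Nat.cast_one, zpow_neg_one]
  field_simp

theorem zOn_insert_of_not_isLoop (M : RankMatroid α) {q : ℝ} (hq : q ≠ 0) (v : α → ℝ) {e : α}
    {T : Finset α} (he : e ∉ T) (h : M.r {e} = 1) :
    M.zOn q v (insert e T) = M.zOn q v T + v e / q * (M.contract e).zOn q v T := by
  rw [M.zOn_insert q v he]
  congr 1
  rw [zOn, mul_sum, mul_sum]
  refine sum_congr rfl fun A hA => ?_
  have h1 : M.r {e} ≤ M.r (insert e A) :=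
    M.mono (singleton_subset_iff.2 (mem_insert_self _ _))
  have h2 : M.r (insert e A) = (M.contract e).r A + 1 := by
    rw [contract_r]
    omega
  rw [h2, Nat.cast_add, neg_add, zpow_add₀ hq, Nat.cast_one, zpow_neg_one]
  field_simp

/-- Parallel reduction. -/
theorem zOn_parallel (M : RankMatroid α) (q : ℝ) (v : α → ℝ) {e f : α} {T : Finset α}
    (he : e ∉ T) (hf : f ∉ insert e T) (h1 : M.r {f, e} = M.r {e}) (h2 : M.r {f, e} = M.r {f}) :
    M.zOn q v (insert f (insert e T)) =
      M.zOn q (Function.update v e ((1 + v e) * (1 + v f) - 1)) (insert e T) := by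
  rw [M.zOn_insert_insert q v he hf, M.zOn_insert_update q v _ he]
  refine sum_congr rfl fun A hA => ?_
  have h3 : M.r (insert f (insert e A)) = M.r (insert e A) :=
    M.r_insert_eq_of_subset (singleton_subset_iff.2 (mem_insert_self _ _)) h1
  have h4 : M.r (insert e (insert f A)) = M.r (insert f A) :=
    M.r_insert_eq_of_subset (singleton_subset_iff.2 (mem_insert_self _ _))
      (by rw [pair_comm]; exact h2)
  rw [← h4, insert_comm e f, h3]
  ring

/-- Series reduction. -/
theorem zOn_series (M : RankMatroid α) {q : ℝ} (hq : q ≠ 0) (v : α → ℝ) {e f : α}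
    {T : Finset α} (he : e ∉ T) (hf : f ∉ insert e T) (h1 : M.r (insert e T) = M.r T + 1)
    (h2 : M.r (insert f T) = M.r T + 1) (hv : q + v e + v f ≠ 0) :
    M.zOn q v (insert f (insert e T)) = (1 + (v e + v f) / q) *
      (M.contract f).zOn q (Function.update v e (v e * v f / (q + v e + v f))) (insert e T) := by
  rw [M.zOn_insert_insert q v he hf, (M.contract f).zOn_insert_update q v _ he, mul_sum]
  refine sum_congr rfl fun A hA => ?_
  have hA' := mem_powerset.1 hA
  have hf1 : M.r {f} = 1 := by
    have := M.r_insert_eq_add_one_of_subset (empty_subset T) h2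
    rwa [insert_empty_eq, M.r_empty] at this
  have h3 := M.r_insert_eq_add_one_of_subset hA' h1
  have h4 := M.r_insert_eq_add_one_of_subset hA' h2
  have h5 : (M.contract f).r A = M.r A := by
    rw [contract_r]
    omega
  have h6 : M.r (insert f (insert e A)) = (M.contract f).r (insert e A) + 1 := by
    have := M.r_le_r_insert f (insert e A)
    rw [contract_r]
    omega
  rw [h3, h4, h5, h6]
  simp only [Nat.cast_add, neg_add, zpow_add₀ hq, Nat.cast_one, zpow_neg_one]
  field_simp
  ring

theorem abs_one_add_parallel_lt {s x y : ℝ} (hs1 : s < 1) (hx : |1 + x| < s)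
    (hy : |1 + y| < s) : |1 + ((1 + x) * (1 + y) - 1)| < s ∧ (1 + x) * (1 + y) - 1 < s ^ 2 - 1 := by
  have h0 := abs_nonneg (1 + x)
  have h1 := abs_nonneg (1 + y)
  have h2 : |(1 + x) * (1 + y)| < s ^ 2 := by
    rw [abs_mul]
    nlinarith
  refine ⟨?_, by linarith [le_abs_self ((1 + x) * (1 + y))]⟩
  rw [add_sub_cancel]
  nlinarith

theorem add_add_neg_of_abs_lt {s x y : ℝ} (hs1 : s < 1) (hx : |1 + x| < s)
    (hy : |1 + y| < s) : 1 - s ^ 2 + x + y < 0 := by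
  rw [abs_lt] at hx hy
  nlinarith

theorem abs_one_add_series_lt {s x y : ℝ} (hs1 : s < 1) (hx : |1 + x| < s)
    (hy : |1 + y| < s) : |1 + x * y / (1 - s ^ 2 + x + y)| < s ∧
      -1 < x * y / (1 - s ^ 2 + x + y) := by
  have hD := add_add_neg_of_abs_lt hs1 hx hy
  have h2 := (abs_one_add_parallel_lt hs1 hx hy).2
  rw [abs_lt] at hx hy
  have h3 : 1 + x * y / (1 - s ^ 2 + x + y) =
      (s ^ 2 - (1 + x) * (1 + y)) / -(1 - s ^ 2 + x + y) := by
    have := hD.ne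
    rw [div_neg, eq_neg_iff_add_eq_zero]
    field_simp
    ring
  have h4 : 0 < 1 + x * y / (1 - s ^ 2 + x + y) := by
    rw [h3]
    exact div_pos (by linarith) (by linarith)
  refine ⟨?_, by linarith⟩
  rw [abs_of_pos h4, h3, div_lt_iff₀ (by linarith)]
  have h5 : 0 < (s - (1 + x)) * (s - (1 + y)) := mul_pos (by linarith) (by linarith)
  have h6 : 0 ≤ s * (1 - s) ^ 2 := mul_nonneg (by linarith) (sq_nonneg _)
  nlinarith

theorem Admissible.of_insert_isLoop {M : RankMatroid α} {s : ℝ} {v : α → ℝ} {e : α}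
    {T : Finset α} (he : e ∉ T) (h : M.Admissible s v (insert e T)) (hl : M.IsLoop e) :
    M.Admissible s v T := by
  have key : ∀ g ∈ T, (M.r ((insert e T).erase g) + 1 = M.r (insert e T) ↔
      M.r (T.erase g) + 1 = M.r T) := fun g hg => by
    rw [erase_insert_of_ne (ne_of_mem_of_not_mem hg he).symm, hl.r_insert, hl.r_insert]
  exact ⟨fun g hg => h.loop g (mem_insert_of_mem hg),
    fun g hg hc => h.coloop g (mem_insert_of_mem hg) ((key g hg).2 hc),
    fun g hg hl hc => h.normal g (mem_insert_of_mem hg) hl (mt (key g hg).1 hc)⟩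

theorem Admissible.of_insert_coloop {M : RankMatroid α} {s : ℝ} {v : α → ℝ} {e : α}
    {T : Finset α} (he : e ∉ T) (h : M.Admissible s v (insert e T))
    (hc : M.r (insert e T) = M.r T + 1) : M.Admissible s v T := by
  have key : ∀ g ∈ T, (M.r ((insert e T).erase g) + 1 = M.r (insert e T) ↔
      M.r (T.erase g) + 1 = M.r T) := fun g hg => by
    rw [erase_insert_of_ne (ne_of_mem_of_not_mem hg he).symm, hc,
      M.r_insert_eq_add_one_of_subset (erase_subset _ _) hc, Nat.add_right_cancel_iff]
  exact ⟨fun g hg => h.loop g (mem_insert_of_mem hg),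
    fun g hg hc => h.coloop g (mem_insert_of_mem hg) ((key g hg).2 hc),
    fun g hg hl hc => h.normal g (mem_insert_of_mem hg) hl (mt (key g hg).1 hc)⟩

theorem admissible_of_abs_lt {M : RankMatroid α} {s : ℝ} {v : α → ℝ} {S : Finset α}
    (hl : ∀ g ∈ S, ¬M.IsLoop g) (hc : ∀ g ∈ S, M.r (S.erase g) + 1 ≠ M.r S)
    (hv : ∀ g ∈ S, |1 + v g| < s) : M.Admissible s v S :=
  ⟨fun g hg h => absurd h (hl g hg), fun g hg h => absurd h (hc g hg), fun g hg _ _ => hv g hg⟩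

theorem admissible_parallel {M : RankMatroid α} {s : ℝ} {v : α → ℝ} {e f : α} {T : Finset α}
    (hs1 : s < 1) (he : e ∉ T) (hf : f ∉ insert e T)
    (hl : ∀ g ∈ insert f (insert e T), ¬M.IsLoop g)
    (hc : ∀ g ∈ insert f (insert e T),
      M.r ((insert f (insert e T)).erase g) + 1 ≠ M.r (insert f (insert e T)))
    (hv : ∀ g ∈ insert f (insert e T), |1 + v g| < s) (hp : M.r {f, e} = M.r {e}) :
    M.Admissible s (Function.update v e ((1 + v e) * (1 + v f) - 1)) (insert e T) := by
  have hpar := abs_one_add_parallel_lt hs1 (hv e (by simp)) (hv f (by simp))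
  refine ⟨fun g hg h => absurd h (hl g (mem_insert_of_mem hg)), fun g hg h => ?_,
    fun g hg _ _ => ?_⟩
  · rcases eq_or_ne g e with rfl | hge
    · rw [Function.update_self]
      exact hpar.2
    · refine absurd ?_ (hc g (mem_insert_of_mem hg))
      rw [erase_insert_of_ne (ne_of_mem_of_not_mem hg hf).symm,
        M.r_insert_eq_of_subset (A := {e}) (B := insert e T) (by simp) hp,
        M.r_insert_eq_of_subset (A := {e}) (by simp [hge.symm]) hp]
      exact h
  · rcases eq_or_ne g e with rfl | hge
    · rw [Function.update_self]
      exact hpar.1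
    · rw [Function.update_of_ne hge]
      exact hv g (mem_insert_of_mem hg)

theorem admissible_series {M : RankMatroid α} {s : ℝ} {v : α → ℝ} {e f : α} {T : Finset α}
    (hs1 : s < 1) (he : e ∉ T) (hf : f ∉ insert e T)
    (hl : ∀ g ∈ insert f (insert e T), ¬M.IsLoop g)
    (hc : ∀ g ∈ insert f (insert e T),
      M.r ((insert f (insert e T)).erase g) + 1 ≠ M.r (insert f (insert e T)))
    (hv : ∀ g ∈ insert f (insert e T), |1 + v g| < s) (hp : M.r (insert f T) = M.r T + 1) :
    (M.contract f).Admissible s (Function.update v e (v e * v f / (1 - s ^ 2 + v e + v f)))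
      (insert e T) := by
  have hser := abs_one_add_series_lt hs1 (hv e (by simp)) (hv f (by simp))
  refine ⟨fun g hg h => ?_, fun g hg h => ?_, fun g hg _ _ => ?_⟩
  · rcases eq_or_ne g e with rfl | hge
    · rw [Function.update_self]
      exact hser.2
    · have hgT := mem_of_mem_insert_of_ne hg hge
      have h1 := M.r_insert_eq_add_one_of_subset (singleton_subset_iff.2 hgT) hp
      have h2 := hl g (mem_insert_of_mem hg)
      have h3 := M.r_singleton_le f
      rw [IsLoop, contract_r] at h
      rw [IsLoop] at h2
      omega
  · refine absurd ?_ (hc g (mem_insert_of_mem hg))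
    rw [erase_insert_of_ne (ne_of_mem_of_not_mem hg hf).symm]
    rw [contract_r, contract_r] at h
    have h1 : M.r {f} ≤ M.r (insert f ((insert e T).erase g)) := M.mono (by simp)
    omega
  · rcases eq_or_ne g e with rfl | hge
    · rw [Function.update_self]
      exact hser.1
    · rw [Function.update_of_ne hge]
      exact hv g (mem_insert_of_mem hg)

theorem sign_zOn_pos {s : ℝ} (hs0 : 0 < s) (hs1 : s < 1) (S : Finset α) :
    ∀ (M : RankMatroid α) (v : α → ℝ), M.Admissible s v S →
      0 < (-1 : ℝ) ^ (M.r S) * M.zOn (1 - s ^ 2) v S := by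
  have hq : 0 < 1 - s ^ 2 := by nlinarith
  induction S using Finset.strongInduction with
  | H S ih =>
  intro M v h
  by_cases hl : ∃ e ∈ S, M.IsLoop e
  · obtain ⟨e, he, hel⟩ := hl
    obtain ⟨T, heT, rfl⟩ : ∃ T, e ∉ T ∧ insert e T = S :=
      ⟨S.erase e, notMem_erase _ _, insert_erase he⟩
    rw [M.zOn_insert_of_isLoop _ v heT hel, hel.r_insert]
    have h1 := ih T (ssubset_insert heT) M v (h.of_insert_isLoop heT hel)
    have h2 : 0 < 1 + v e := by linarith [h.loop e he hel]
    rw [mul_left_comm]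
    positivity
  by_cases hc : ∃ e ∈ S, M.r (S.erase e) + 1 = M.r S
  · obtain ⟨e, he, hec⟩ := hc
    obtain ⟨T, heT, rfl⟩ : ∃ T, e ∉ T ∧ insert e T = S :=
      ⟨S.erase e, notMem_erase _ _, insert_erase he⟩
    have hve := h.coloop e he hec
    rw [erase_insert heT] at hec
    rw [M.zOn_insert_of_coloop hq.ne' v heT hec.symm, ← hec, pow_succ]
    have h1 := ih T (ssubset_insert heT) M v (h.of_insert_coloop heT hec.symm)
    have h2 : 0 < -(1 + v e / (1 - s ^ 2)) := by
      have : v e / (1 - s ^ 2) < -1 := by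
        rw [div_lt_iff₀ hq]
        linarith
      linarith
    have := mul_pos h2 h1
    linarith
  push Not at hl hc
  have hv : ∀ g ∈ S, |1 + v g| < s := fun g hg => h.normal g hg (hl g hg) (hc g hg)
  have hr1 : ∀ g ∈ S, M.r {g} = 1 := fun g hg => by
    have h1 := hl g hg
    have h2 := M.r_singleton_le g
    rw [IsLoop] at h1
    omega
  by_cases hp : ∃ e ∈ S, ∃ f ∈ S, f ≠ e ∧ M.r {f, e} = 1
  · obtain ⟨e, he, f, hf, hfe, hp⟩ := hp
    obtain ⟨T, heT, hfT, rfl⟩ : ∃ T, e ∉ T ∧ f ∉ insert e T ∧ insert f (insert e T) = S :=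
      ⟨(S.erase f).erase e, notMem_erase _ _, by simp [hfe], by
        rw [insert_erase (mem_erase.2 ⟨hfe.symm, he⟩), insert_erase hf]⟩
    have hpe : M.r {f, e} = M.r {e} := hp.trans (hr1 e he).symm
    rw [M.zOn_parallel _ v heT hfT hpe (hp.trans (hr1 f hf).symm),
      M.r_insert_eq_of_subset (A := {e}) (by simp) hpe]
    exact ih _ (ssubset_insert hfT) M _ (admissible_parallel hs1 heT hfT hl hc hv hpe)
  by_cases hs : ∃ e ∈ S, ∃ f ∈ S, f ≠ e ∧ M.r ((S.erase f).erase e) + 1 = M.r S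
  · obtain ⟨e, he, f, hf, hfe, hs⟩ := hs
    obtain ⟨T, heT, hfT, rfl⟩ : ∃ T, e ∉ T ∧ f ∉ insert e T ∧ insert f (insert e T) = S :=
      ⟨(S.erase f).erase e, notMem_erase _ _, by simp [hfe], by
        rw [insert_erase (mem_erase.2 ⟨hfe.symm, he⟩), insert_erase hf]⟩
    rw [erase_insert hfT, erase_insert heT] at hs
    have hce := hc e he
    have hcf := hc f hf
    rw [erase_insert_of_ne hfe, erase_insert heT] at hce
    rw [erase_insert hfT] at hcf
    have i1 := M.r_insert_le e T
    have i2 := M.r_insert_le f T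
    have i3 := M.r_le_r_insert e T
    have i4 := M.r_le_r_insert f T
    have h1 : M.r (insert e T) = M.r T + 1 := by omega
    have h2 : M.r (insert f T) = M.r T + 1 := by omega
    have hD := add_add_neg_of_abs_lt hs1 (hv e he) (hv f hf)
    rw [M.zOn_series hq.ne' v heT hfT h1 h2 hD.ne]
    have h3 := ih _ (ssubset_insert hfT) _ _ (admissible_series hs1 heT hfT hl hc hv h2)
    rw [contract_r, hr1 f hf, ← hs, Nat.add_sub_cancel] at h3
    rw [← hs, pow_succ]
    have h4 : 0 < -(1 + (v e + v f) / (1 - s ^ 2)) := by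
      have : (v e + v f) / (1 - s ^ 2) < -1 := by
        rw [div_lt_iff₀ hq]
        linarith
      linarith
    have := mul_pos h4 h3
    linarith
  push Not at hp hs
  rcases S.eq_empty_or_nonempty with rfl | ⟨e, he⟩
  · simp [zOn, M.r_empty]
  obtain ⟨T, heT, rfl⟩ : ∃ T, e ∉ T ∧ insert e T = S :=
    ⟨S.erase e, notMem_erase _ _, insert_erase he⟩
  have hne : ∀ g ∈ T, g ≠ e := fun g hg => ne_of_mem_of_not_mem hg heT
  have hvT : ∀ g ∈ T, |1 + v g| < s := fun g hg => hv g (mem_insert_of_mem hg)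
  have hrT : M.r (insert e T) = M.r T := by
    have h1 := hc e he
    rw [erase_insert heT] at h1
    have h2 := M.r_insert_le e T
    have h3 := M.r_le_r_insert e T
    omega
  have hdel := ih T (ssubset_insert heT) M v <| admissible_of_abs_lt
    (fun g hg => hl g (mem_insert_of_mem hg))
    (fun g hg h => by
      have h1 := hs g (mem_insert_of_mem hg) e he (hne g hg).symm
      rw [erase_insert heT, hrT] at h1
      exact h1 h) hvT
  have hcon := ih T (ssubset_insert heT) (M.contract e) v <| admissible_of_abs_lt
    (fun g hg h => by
      have h1 := hp g (mem_insert_of_mem hg) e he (hne g hg).symm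
      have h2 : M.r {e} ≤ M.r {e, g} := M.mono (by simp)
      have h3 := hr1 e he
      rw [IsLoop, contract_r] at h
      omega)
    (fun g hg h => by
      have h1 := hc g (mem_insert_of_mem hg)
      have h2 : M.r {e} ≤ M.r (insert e (T.erase g)) := M.mono (by simp)
      rw [contract_r, contract_r] at h
      rw [erase_insert_of_ne (hne g hg).symm] at h1
      omega) hvT
  have hre : M.r (insert e T) = (M.contract e).r T + 1 := by
    have h1 : M.r {e} ≤ M.r (insert e T) := M.mono (by simp)
    have h2 := hr1 e he
    rw [contract_r]
    omega
  have hneg : 0 < -(v e / (1 - s ^ 2)) := by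
    rw [← neg_div]
    exact div_pos (by linarith [(abs_lt.1 (hv e he)).2]) hq
  rw [M.zOn_insert_of_not_isLoop hq.ne' v heT (hr1 e he), mul_add]
  refine add_pos (by rw [hrT]; exact hdel) ?_
  rw [hre, pow_succ]
  have := mul_pos hneg hcon
  linarith

end RankMatroid

/-- Let `M` be a matroid of rank `r(M)` and `0 < q < 1`.  Suppose `v_e > -1` for every
loop, `v_e < -q` for every coloop, and `-1 - √(1-q) < v_e < -1 + √(1-q)` for every
element that is neither a loop nor a coloop.  Then `(-1)^{r(M)} Z̃_M(q,v) > 0`. -/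
theorem matZ_sign_zero_lt_q_lt_one {α : Type*} [DecidableEq α] [Fintype α]
    (M : RankMatroid α) (q : ℝ) (hq0 : 0 < q) (hq1 : q < 1) (v : α → ℝ)
    (hloop : ∀ e : α, M.IsLoop e → -1 < v e)
    (hcoloop : ∀ e : α, M.IsColoop e → v e < -q)
    (hnormal : ∀ e : α, ¬M.IsLoop e → ¬M.IsColoop e →
      -1 - Real.sqrt (1 - q) < v e ∧ v e < -1 + Real.sqrt (1 - q)) :
    0 < (-1 : ℝ) ^ (M.r Finset.univ) * matZ M q v := by
  have hs0 : 0 < Real.sqrt (1 - q) := Real.sqrt_pos.2 (by linarith)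
  have hs2 : Real.sqrt (1 - q) ^ 2 = 1 - q := Real.sq_sqrt (by linarith)
  have hs1 : Real.sqrt (1 - q) < 1 := by nlinarith
  have h := RankMatroid.sign_zOn_pos hs0 hs1 Finset.univ M v
    ⟨fun e _ => hloop e, fun e _ he => by
      rw [hs2]
      linarith [hcoloop e he], fun e _ hl hc => by
      have := hnormal e hl hc
      exact abs_lt.2 ⟨by linarith, by linarith⟩⟩
  rwa [hs2, sub_sub_cancel] at h
end
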